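/- arXiv:math/0207055 — 5 statements merged into one kernel-verified Lean document; each statement's English description precedes it below -/
import Mathlib

section
/- The function J₀ defined by J₀(x) = (1/π)·∫₀^π cos(x·sin θ) dθ satisfies Bessel's differential equation of order zero: for every real x, x·J₀''(x) + J₀'(x) + x·J₀(x) = 0. -/
open Real MeasureTheory intervalIntegral

noncomputable def besselJ0 (x : ℝ) : ℝ :=
  (1 / Real.pi) * ∫ θ in (0:ℝ)..Real.pi, Real.cos (x * Real.sin θ)

noncomputable def besselJ1 (x : ℝ) : ℝ :=
  (1 / Real.pi) * ∫ θ in (0:ℝ)..Real.pi, Real.cos (θ - x * Real.sin θ)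

noncomputable def struveH0 (x : ℝ) : ℝ :=
  (2 / Real.pi) * ∫ θ in (0:ℝ)..(Real.pi / 2), Real.sin (x * Real.cos θ)

noncomputable def struveH1 (x : ℝ) : ℝ :=
  (2 * x / Real.pi) * ∫ θ in (0:ℝ)..(Real.pi / 2),
    Real.sin (x * Real.cos θ) * (Real.sin θ) ^ 2

noncomputable def besselPhi (x : ℝ) : ℝ :=
  x * besselJ0 x +
    (Real.pi * x / 2) * (struveH0 x * besselJ1 x - struveH1 x * besselJ0 x)

noncomputable def haarPsi (t : ℝ) : ℝ :=
  if t ∈ Set.Ico (0 : ℝ) (1 / 2) then 1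
  else if t ∈ Set.Ico (1 / 2 : ℝ) 1 then -1
  else 0

noncomputable def haarPsiJK (j k : ℕ) (t : ℝ) : ℝ :=
  2 ^ ((j : ℝ) / 2) * haarPsi (2 ^ j * t - k)

noncomputable def errorFun (x : ℝ) : ℝ :=
  (2 / Real.sqrt Real.pi) * ∫ t in (0:ℝ)..x, Real.exp (-t ^ 2)

theorem hasDerivAt_intervalIntegral_of_norm_deriv_le {F F' : ℝ → ℝ → ℝ} {a b C : ℝ}
    (hF : ∀ x, Continuous (F x)) (hF' : ∀ x, Continuous (F' x))
    (hC : ∀ x t, ‖F' x t‖ ≤ C) (hd : ∀ x t, HasDerivAt (fun y => F y t) (F' x t) x) (x : ℝ) :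
    HasDerivAt (fun y => ∫ t in a..b, F y t) (∫ t in a..b, F' x t) x :=
  (intervalIntegral.hasDerivAt_integral_of_dominated_loc_of_deriv_le (bound := fun _ => C)
    Filter.univ_mem (Filter.Eventually.of_forall fun y => (hF y).aestronglyMeasurable)
    ((hF x).intervalIntegrable a b) (hF' x).aestronglyMeasurable
    (Filter.Eventually.of_forall fun t _ y _ => hC y t) intervalIntegrable_const
    (Filter.Eventually.of_forall fun t _ y _ => hd y t)).2

theorem hasDerivAt_besselJ0 (x : ℝ) :
    HasDerivAt besselJ0
      ((1 / π) * ∫ θ in (0 : ℝ)..π, -(Real.sin (x * Real.sin θ) * Real.sin θ)) x := by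
  refine (hasDerivAt_intervalIntegral_of_norm_deriv_le
    (F := fun y θ => Real.cos (y * Real.sin θ))
    (F' := fun y θ => -(Real.sin (y * Real.sin θ) * Real.sin θ)) (C := 1)
    (fun y => by fun_prop) (fun y => by fun_prop) (fun y θ => ?_) (fun y θ => ?_) x).const_mul _
  · rw [norm_neg, norm_mul]
    exact mul_le_one₀ (Real.abs_sin_le_one _) (norm_nonneg _) (Real.abs_sin_le_one _)
  · simpa using ((hasDerivAt_id y).mul_const (Real.sin θ)).cos

theorem hasDerivAt_deriv_besselJ0 (x : ℝ) :
    HasDerivAt (deriv besselJ0)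
      ((1 / π) * ∫ θ in (0 : ℝ)..π, -(Real.cos (x * Real.sin θ) * Real.sin θ ^ 2)) x := by
  rw [funext fun y => (hasDerivAt_besselJ0 y).deriv]
  refine (hasDerivAt_intervalIntegral_of_norm_deriv_le
    (F := fun y θ => -(Real.sin (y * Real.sin θ) * Real.sin θ))
    (F' := fun y θ => -(Real.cos (y * Real.sin θ) * Real.sin θ ^ 2)) (C := 1)
    (fun y => by fun_prop) (fun y => by fun_prop) (fun y θ => ?_) (fun y θ => ?_) x).const_mul _
  · rw [norm_neg, norm_mul, norm_pow]
    exact mul_le_one₀ (Real.abs_cos_le_one _) (by positivity)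
      (pow_le_one₀ (norm_nonneg _) (Real.abs_sin_le_one _))
  · refine ((((hasDerivAt_id y).mul_const (Real.sin θ)).sin).mul_const
      (Real.sin θ)).neg.congr_deriv ?_
    simp only [id]
    ring

theorem integral_deriv_cos_mul_sin_mul_sin (x : ℝ) :
    ∫ θ in (0 : ℝ)..π, (x * (Real.cos (x * Real.sin θ) * Real.cos θ ^ 2)
      - Real.sin (x * Real.sin θ) * Real.sin θ) = 0 := by
  rw [integral_eq_sub_of_hasDerivAt (f := fun θ => Real.cos θ * Real.sin (x * Real.sin θ))]
  · simp
  · intro θ _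
    refine ((Real.hasDerivAt_cos θ).mul
      ((Real.hasDerivAt_sin θ).const_mul x).sin).congr_deriv ?_
    ring
  · exact Continuous.intervalIntegrable (by fun_prop) _ _

theorem besselJ0_satisfies_bessel_ode_order_zero (x : ℝ) :
    x * deriv (deriv besselJ0) x + deriv besselJ0 x + x * besselJ0 x = 0 := by
  rw [(hasDerivAt_deriv_besselJ0 x).deriv, (hasDerivAt_besselJ0 x).deriv, besselJ0]
  have h : x * (∫ θ in (0 : ℝ)..π, -(Real.cos (x * Real.sin θ) * Real.sin θ ^ 2))
      + (∫ θ in (0 : ℝ)..π, -(Real.sin (x * Real.sin θ) * Real.sin θ))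
      + x * (∫ θ in (0 : ℝ)..π, Real.cos (x * Real.sin θ)) = 0 := by
    rw [← intervalIntegral.integral_const_mul, ← intervalIntegral.integral_const_mul,
      ← intervalIntegral.integral_add, ← intervalIntegral.integral_add]
    · refine Eq.trans ?_ (integral_deriv_cos_mul_sin_mul_sin x)
      apply intervalIntegral.integral_congr
      intro θ _
      simp only [Real.cos_sq']
      ring
    all_goals exact Continuous.intervalIntegrable (by fun_prop) _ _
  linear_combination (1 / π) * h
end

section
/- For every real x, the derivative of J₀ at x equals −J₁(x), where J₀(x) = (1/π)·∫₀^π cos(x·sin θ) dθ and J₁(x) = (1/π)·∫₀^π cos(θ − x·sin θ) dθ. -/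
open Real MeasureTheory intervalIntegral

theorem integral_cos_mul_cos_mul_sin (x : ℝ) :
    ∫ θ in (0:ℝ)..Real.pi, Real.cos θ * Real.cos (x * Real.sin θ) = 0 := by
  have h := intervalIntegral.integral_comp_sub_left (a := 0) (b := Real.pi)
    (fun θ => Real.cos θ * Real.cos (x * Real.sin θ)) Real.pi
  simp only [Real.cos_pi_sub, Real.sin_pi_sub, neg_mul, intervalIntegral.integral_neg,
    sub_self, sub_zero] at h
  linarith

theorem integral_cos_sub_mul_sin (x : ℝ) :
    ∫ θ in (0:ℝ)..Real.pi, Real.cos (θ - x * Real.sin θ) =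
      ∫ θ in (0:ℝ)..Real.pi, Real.sin θ * Real.sin (x * Real.sin θ) := by
  simp only [Real.cos_sub]
  rw [intervalIntegral.integral_add (Continuous.intervalIntegrable (by fun_prop) _ _)
    (Continuous.intervalIntegrable (by fun_prop) _ _), integral_cos_mul_cos_mul_sin, zero_add]

theorem hasDerivAt_integral_cos_mul_sin (x : ℝ) :
    HasDerivAt (fun y => ∫ θ in (0:ℝ)..Real.pi, Real.cos (y * Real.sin θ))
      (∫ θ in (0:ℝ)..Real.pi, -(Real.sin θ * Real.sin (x * Real.sin θ))) x := by
  refine (intervalIntegral.hasDerivAt_integral_of_dominated_loc_of_deriv_le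
    (F := fun y θ => Real.cos (y * Real.sin θ))
    (F' := fun y θ => -(Real.sin θ * Real.sin (y * Real.sin θ)))
    (bound := fun _ => 1) Filter.univ_mem
    (Filter.Eventually.of_forall fun y => Continuous.aestronglyMeasurable (by fun_prop))
    (Continuous.intervalIntegrable (by fun_prop) _ _)
    (Continuous.aestronglyMeasurable (by fun_prop))
    (Filter.Eventually.of_forall fun θ _ y _ => ?_)
    intervalIntegrable_const
    (Filter.Eventually.of_forall fun θ _ y _ => ?_)).2
  · rw [norm_neg, norm_mul]
    exact mul_le_one₀ (Real.abs_sin_le_one _) (norm_nonneg _) (Real.abs_sin_le_one _)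
  · exact ((hasDerivAt_id y).mul_const (Real.sin θ)).cos.congr_deriv (by simp only [id]; ring)

theorem deriv_besselJ0_eq_neg_besselJ1 (x : ℝ) :
    deriv besselJ0 x = -besselJ1 x := by
  have h := ((hasDerivAt_integral_cos_mul_sin x).const_mul (1 / Real.pi)).deriv
  rw [intervalIntegral.integral_neg, ← integral_cos_sub_mul_sin, mul_neg] at h
  exact h
end

section
/- The function J₁ defined by J₁(x) = (1/π)·∫₀^π cos(θ − x·sin θ) dθ satisfies Bessel's differential equation of order one: for every real x, x²·J₁''(x) + x·J₁'(x) + (x² − 1)·J₁(x) = 0. -/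
open Real MeasureTheory intervalIntegral

/-- Differentiation under the integral sign over a compact interval, for an integrand whose
derivative in the parameter is uniformly bounded and continuous in the integration variable. -/
theorem hasDerivAt_intervalIntegral_of_bounded_deriv {F F' : ℝ → ℝ → ℝ} {a b C : ℝ}
    (hF : ∀ x, Continuous (F x)) (hF' : ∀ x, Continuous (F' x))
    (hbound : ∀ x t, ‖F' x t‖ ≤ C) (hderiv : ∀ x t, HasDerivAt (fun y => F y t) (F' x t) x)
    (x : ℝ) :
    HasDerivAt (fun y => ∫ t in a..b, F y t) (∫ t in a..b, F' x t) x :=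
  (hasDerivAt_integral_of_dominated_loc_of_deriv_le (bound := fun _ => C) Filter.univ_mem
    (Filter.Eventually.of_forall fun y => (hF y).aestronglyMeasurable)
    ((hF x).intervalIntegrable _ _) (hF' x).aestronglyMeasurable
    (Filter.Eventually.of_forall fun t _ y _ => hbound y t)
    intervalIntegrable_const
    (Filter.Eventually.of_forall fun t _ y _ => hderiv y t)).2

theorem hasDerivAt_sub_mul_sin (θ x : ℝ) :
    HasDerivAt (fun y => θ - y * Real.sin θ) (-Real.sin θ) x := by
  simpa using ((hasDerivAt_id x).mul_const (Real.sin θ)).const_sub θ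

theorem hasDerivAt_besselJ1 (x : ℝ) :
    HasDerivAt besselJ1
      ((1 / Real.pi) * ∫ θ in (0:ℝ)..Real.pi, Real.sin θ * Real.sin (θ - x * Real.sin θ)) x := by
  refine HasDerivAt.const_mul _ (hasDerivAt_intervalIntegral_of_bounded_deriv
    (F' := fun y θ => Real.sin θ * Real.sin (θ - y * Real.sin θ)) (C := 1)
    (fun y => by fun_prop) (fun y => by fun_prop) (fun y θ => ?_) (fun y θ => ?_) x)
  · rw [norm_mul]
    exact mul_le_one₀ (abs_sin_le_one _) (norm_nonneg _) (abs_sin_le_one _)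
  · exact (hasDerivAt_sub_mul_sin θ y).cos.congr_deriv (by ring)

theorem hasDerivAt_deriv_besselJ1 (x : ℝ) :
    HasDerivAt (deriv besselJ1)
      ((1 / Real.pi) *
        ∫ θ in (0:ℝ)..Real.pi, -(Real.sin θ ^ 2 * Real.cos (θ - x * Real.sin θ))) x := by
  rw [show deriv besselJ1 = _ from funext fun y => (hasDerivAt_besselJ1 y).deriv]
  refine HasDerivAt.const_mul _ (hasDerivAt_intervalIntegral_of_bounded_deriv
    (F' := fun y θ => -(Real.sin θ ^ 2 * Real.cos (θ - y * Real.sin θ))) (C := 1)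
    (fun y => by fun_prop) (fun y => by fun_prop) (fun y θ => ?_) (fun y θ => ?_) x)
  · rw [norm_neg, norm_mul, norm_pow]
    exact mul_le_one₀ (pow_le_one₀ (norm_nonneg _) (abs_sin_le_one _)) (norm_nonneg _)
      (abs_cos_le_one _)
  · exact ((hasDerivAt_sub_mul_sin θ y).sin.const_mul (Real.sin θ)).congr_deriv (by ring)

/-- Applying the Bessel operator to the integrand of `besselJ1` gives an exact derivative in `θ`. -/
theorem hasDerivAt_bessel_primitive (x θ : ℝ) :
    HasDerivAt (fun θ => -((1 + x * Real.cos θ) * Real.sin (θ - x * Real.sin θ)))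
      (x ^ 2 * -(Real.sin θ ^ 2 * Real.cos (θ - x * Real.sin θ))
        + x * (Real.sin θ * Real.sin (θ - x * Real.sin θ))
        + (x ^ 2 - 1) * Real.cos (θ - x * Real.sin θ)) θ := by
  have hphase : HasDerivAt (fun θ => θ - x * Real.sin θ) (1 - x * Real.cos θ) θ :=
    (hasDerivAt_id θ).sub ((Real.hasDerivAt_sin θ).const_mul x)
  have hfactor : HasDerivAt (fun θ => 1 + x * Real.cos θ) (x * -Real.sin θ) θ :=
    ((Real.hasDerivAt_cos θ).const_mul x).const_add 1
  refine (hfactor.mul hphase.sin).neg.congr_deriv ?_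
  rw [Real.sin_sq]
  ring

theorem besselJ1_satisfies_bessel_ode_order_one (x : ℝ) :
    x ^ 2 * deriv (deriv besselJ1) x + x * deriv besselJ1 x
      + (x ^ 2 - 1) * besselJ1 x = 0 := by
  have hint : ∀ f : ℝ → ℝ, Continuous f → IntervalIntegrable f volume 0 Real.pi :=
    fun f hf => hf.intervalIntegrable _ _
  have key := integral_eq_sub_of_hasDerivAt (a := 0) (b := Real.pi)
    (fun θ _ => hasDerivAt_bessel_primitive x θ) (hint _ (by fun_prop))
  rw [integral_add (hint _ (by fun_prop)) (hint _ (by fun_prop)),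
    integral_add (hint _ (by fun_prop)) (hint _ (by fun_prop)),
    intervalIntegral.integral_const_mul, intervalIntegral.integral_const_mul,
    intervalIntegral.integral_const_mul] at key
  simp only [Real.sin_pi, Real.sin_zero, mul_zero, sub_zero, neg_zero] at key
  rw [(hasDerivAt_deriv_besselJ1 x).deriv, (hasDerivAt_besselJ1 x).deriv, besselJ1]
  linear_combination (1 / Real.pi) * key
end

section
/- For all natural numbers j, k and every real p > 0, the order-1 Hankel transform of the Haar wavelet ψ_{jk} satisfies ∫₀^∞ ψ_{jk}(r)·J₁(p·r) dr = (2^{j/2}/p)·(J₀(p·k·2^{−j}) + J₀(p·(k+1)·2^{−j}) − 2·J₀(p·(k + 1/2)·2^{−j})). -/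
open Real MeasureTheory intervalIntegral

theorem besselJ1_eq (x : ℝ) :
    besselJ1 x = (1 / Real.pi) * ∫ θ in (0:ℝ)..Real.pi, Real.sin θ * Real.sin (x * Real.sin θ) := by
  have hsymm : ∫ θ in (0:ℝ)..Real.pi, Real.cos θ * Real.cos (x * Real.sin θ) = 0 := by
    have h := intervalIntegral.integral_comp_sub_left (a := 0) (b := Real.pi)
      (fun θ => Real.cos θ * Real.cos (x * Real.sin θ)) Real.pi
    simp only [Real.cos_pi_sub, Real.sin_pi_sub, sub_self, sub_zero, neg_mul,
      intervalIntegral.integral_neg] at h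
    linarith
  have hadd : ∫ θ in (0:ℝ)..Real.pi, Real.cos (θ - x * Real.sin θ) =
      (∫ θ in (0:ℝ)..Real.pi, Real.cos θ * Real.cos (x * Real.sin θ)) +
        ∫ θ in (0:ℝ)..Real.pi, Real.sin θ * Real.sin (x * Real.sin θ) := by
    rw [← intervalIntegral.integral_add
      (Continuous.intervalIntegrable (by fun_prop) _ _)
      (Continuous.intervalIntegrable (by fun_prop) _ _)]
    simp only [Real.cos_sub]
  rw [besselJ1, hadd, hsymm, zero_add]

theorem hasDerivAt_besselJ0_s10 (x : ℝ) : HasDerivAt besselJ0 (-besselJ1 x) x := by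
  have h := (intervalIntegral.hasDerivAt_integral_of_dominated_loc_of_deriv_le
    (μ := volume) (a := 0) (b := Real.pi) (s := Set.univ) (x₀ := x) (bound := fun _ => 1)
    (F := fun y θ => Real.cos (y * Real.sin θ))
    (F' := fun y θ => -(Real.sin θ * Real.sin (y * Real.sin θ)))
    Filter.univ_mem
    (Filter.Eventually.of_forall fun y =>
      Continuous.aestronglyMeasurable (by fun_prop))
    (Continuous.intervalIntegrable (by fun_prop) _ _)
    (Continuous.aestronglyMeasurable (by fun_prop))
    (Filter.Eventually.of_forall fun θ _ y _ => by
      rw [norm_neg, norm_mul]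
      exact mul_le_one₀ (Real.abs_sin_le_one _) (norm_nonneg _) (Real.abs_sin_le_one _))
    (Continuous.intervalIntegrable (by fun_prop) _ _)
    (Filter.Eventually.of_forall fun θ _ y _ => by
      have h1 := ((hasDerivAt_id y).mul_const (Real.sin θ)).cos
      exact h1.congr_deriv (by simp only [id]; ring))).2
  have h2 := h.const_mul (1 / Real.pi)
  rw [intervalIntegral.integral_neg, mul_neg, ← besselJ1_eq] at h2
  exact h2

theorem continuous_besselJ1 : Continuous besselJ1 := by
  unfold besselJ1
  exact continuous_const.mul
    (intervalIntegral.continuous_parametric_intervalIntegral_of_continuous' (by fun_prop) _ _)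

theorem integral_besselJ1_mul {p : ℝ} (hp : p ≠ 0) (a b : ℝ) :
    ∫ r in a..b, besselJ1 (p * r) = (besselJ0 (p * a) - besselJ0 (p * b)) / p := by
  have hJ := continuous_besselJ1
  rw [intervalIntegral.integral_eq_sub_of_hasDerivAt
    (f := fun r => -(besselJ0 (p * r) / p)) (fun r _ => ?_)
    (Continuous.intervalIntegrable (by fun_prop) _ _)]
  · ring
  · have h := (((hasDerivAt_besselJ0_s10 (p * r)).comp r
      ((hasDerivAt_id r).const_mul p)).div_const p).neg
    exact h.congr_deriv (by field_simp)

theorem haarPsi_eq_indicator (t : ℝ) :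
    haarPsi t = (Set.Ico (0 : ℝ) (1 / 2)).indicator 1 t -
      (Set.Ico (1 / 2 : ℝ) 1).indicator 1 t := by
  unfold haarPsi
  by_cases h1 : t ∈ Set.Ico (0 : ℝ) (1 / 2)
  · have h2 : t ∉ Set.Ico (1 / 2 : ℝ) 1 := fun h => absurd h1.2 (not_lt.2 h.1)
    simp only [if_pos h1, Set.indicator_of_mem h1, Set.indicator_of_notMem h2, Pi.one_apply,
      sub_zero]
  · by_cases h2 : t ∈ Set.Ico (1 / 2 : ℝ) 1
    · simp only [if_neg h1, if_pos h2, Set.indicator_of_notMem h1, Set.indicator_of_mem h2,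
        Pi.one_apply, zero_sub]
    · simp only [if_neg h1, if_neg h2, Set.indicator_of_notMem h1, Set.indicator_of_notMem h2,
        sub_zero]

theorem mul_sub_mem_Ico_iff {c : ℝ} (hc : 0 < c) (k u v r : ℝ) :
    c * r - k ∈ Set.Ico u v ↔ r ∈ Set.Ico ((k + u) * c⁻¹) ((k + v) * c⁻¹) := by
  rw [Set.mem_Ico, Set.mem_Ico, ← div_eq_mul_inv, ← div_eq_mul_inv, div_le_iff₀ hc, lt_div_iff₀ hc,
    mul_comm r c]
  constructor <;> rintro ⟨h1, h2⟩ <;> constructor <;> linarith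

theorem integral_Ioi_indicator_Ico {f : ℝ → ℝ} {a b : ℝ} (ha : 0 ≤ a) (hab : a ≤ b) :
    ∫ r in Set.Ioi (0 : ℝ), (Set.Ico a b).indicator f r = ∫ r in a..b, f r := by
  rw [← integral_Ici_eq_integral_Ioi, setIntegral_indicator measurableSet_Ico,
    Set.inter_eq_right.2 (Set.Ico_subset_Ici_self.trans (Set.Ici_subset_Ici.2 ha)), integral_Ico_eq_integral_Ioc,
    intervalIntegral.integral_of_le hab]

theorem integrable_indicator_Ico {f : ℝ → ℝ} (hf : Continuous f) (a b : ℝ) :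
    Integrable ((Set.Ico a b).indicator f) :=
  (integrable_indicator_iff measurableSet_Ico).2
    (hf.integrableOn_Icc.mono_set Set.Ico_subset_Icc_self)

theorem hankel1_haar_wavelet (j k : ℕ) (p : ℝ) (hp : 0 < p) :
    ∫ r in Set.Ioi (0 : ℝ), haarPsiJK j k r * besselJ1 (p * r)
      = (2 ^ ((j : ℝ) / 2) / p) *
          (besselJ0 (p * ((k : ℝ) * 2 ^ (-(j : ℝ))))
            + besselJ0 (p * (((k : ℝ) + 1) * 2 ^ (-(j : ℝ))))
            - 2 * besselJ0 (p * (((k : ℝ) + 1 / 2) * 2 ^ (-(j : ℝ))))) := by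
  rw [show (2 : ℝ) ^ (-(j : ℝ)) = ((2 : ℝ) ^ j)⁻¹ by
    rw [Real.rpow_neg zero_le_two, Real.rpow_natCast]]
  have hc : (0 : ℝ) < 2 ^ j := by positivity
  set c : ℝ := 2 ^ j with hcdef
  have hci : 0 ≤ c⁻¹ := (inv_pos.2 hc).le
  have hk : (0 : ℝ) ≤ k := k.cast_nonneg
  have hJ := continuous_besselJ1
  have hf : Continuous fun r => besselJ1 (p * r) := by fun_prop
  have hint : ∀ r, haarPsiJK j k r * besselJ1 (p * r) = 2 ^ ((j : ℝ) / 2) *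
      ((Set.Ico ((k : ℝ) * c⁻¹) ((k + 1 / 2) * c⁻¹)).indicator (fun r => besselJ1 (p * r)) r -
        (Set.Ico (((k : ℝ) + 1 / 2) * c⁻¹) ((k + 1) * c⁻¹)).indicator
          (fun r => besselJ1 (p * r)) r) := by
    intro r
    have h1 := mul_sub_mem_Ico_iff hc k 0 (1 / 2) r
    have h2 := mul_sub_mem_Ico_iff hc k (1 / 2) 1 r
    rw [add_zero] at h1
    rw [haarPsiJK, haarPsi_eq_indicator, ← hcdef]
    simp only [Set.indicator_apply, h1, h2, Pi.one_apply]
    split_ifs <;> ring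
  simp only [hint]
  rw [MeasureTheory.integral_const_mul, MeasureTheory.integral_sub
      (integrable_indicator_Ico hf _ _).integrableOn
      (integrable_indicator_Ico hf _ _).integrableOn,
    integral_Ioi_indicator_Ico (by positivity) (by gcongr; linarith),
    integral_Ioi_indicator_Ico (by positivity) (by gcongr; norm_num),
    integral_besselJ1_mul hp.ne', integral_besselJ1_mul hp.ne']
  ring
end

section
/- For all real numbers a > 0 and p ≥ 0, the Weber–Schafheitlin-type integral holds: ∫₀^∞ e^{−a²·r²}·r²·J₁(p·r) dr = (p/(4·a⁴))·e^{−p²/(4·a²)}. -/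
open Real MeasureTheory intervalIntegral

/-- Fourier cosine transform of a Gaussian. -/
theorem integral_cos_mul_exp_neg_mul_sq {b : ℝ} (hb : 0 < b) (t : ℝ) :
    ∫ x : ℝ, Real.cos (t * x) * Real.exp (-b * x ^ 2)
      = √(π / b) * Real.exp (-t ^ 2 / (4 * b)) := by
  have h := fourierIntegral_gaussian (b := (b : ℂ)) (by simpa using hb) (t : ℂ)
  have hint : Integrable fun x : ℝ ↦
      Complex.exp (Complex.I * t * x) * Complex.exp (-(b : ℂ) * (x : ℂ) ^ 2) := by
    have := integrable_cexp_quadratic (b := (b : ℂ)) (by simpa using hb) (Complex.I * t) 0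
    refine this.congr (.of_forall fun x ↦ ?_)
    simp only [← Complex.exp_add]
    congr 1
    ring
  have hre := integral_re hint
  simp only [RCLike.re_to_complex] at hre
  rw [h] at hre
  have hrhs : ((π : ℂ) / b) ^ (1 / 2 : ℂ) * Complex.exp (-(t : ℂ) ^ 2 / (4 * b))
      = ((√(π / b) * Real.exp (-t ^ 2 / (4 * b)) : ℝ) : ℂ) := by
    rw [Real.sqrt_eq_rpow]
    push_cast [Complex.ofReal_cpow (div_pos pi_pos hb).le]
    rfl
  rw [hrhs, Complex.ofReal_re] at hre
  rw [← hre]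
  congr 1 with x
  have h₁ : Complex.I * t * x = ((t * x : ℝ) : ℂ) * Complex.I := by push_cast; ring
  have h₂ : -(b : ℂ) * (x : ℂ) ^ 2 = ((-b * x ^ 2 : ℝ) : ℂ) := by push_cast; ring
  rw [h₁, h₂, ← Complex.ofReal_exp, Complex.re_mul_ofReal, Complex.exp_ofReal_mul_I_re]

theorem integral_sin_mul_mul_exp_neg_mul_sq {b : ℝ} (hb : 0 < b) (t : ℝ) :
    ∫ x : ℝ, Real.sin (t * x) * (x * Real.exp (-b * x ^ 2))
      = t / (2 * b) * (√(π / b) * Real.exp (-t ^ 2 / (4 * b))) := by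
  have hv (x : ℝ) : HasDerivAt (fun y : ℝ ↦ -(1 / (2 * b)) * Real.exp (-b * y ^ 2))
      (x * Real.exp (-b * x ^ 2)) x := by
    convert! (((hasDerivAt_pow 2 x).const_mul (-b)).exp).const_mul (-(1 / (2 * b))) using 1
    norm_num
    field_simp
  have hu (x : ℝ) : HasDerivAt (fun y : ℝ ↦ Real.sin (t * y)) (t * Real.cos (t * x)) x := by
    convert! ((hasDerivAt_id x).const_mul t).sin using 1
    simp [mul_comm]
  have hgauss := (integrable_exp_neg_mul_sq hb).const_mul (-(1 / (2 * b)))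
  have hsin : ∀ x : ℝ, ‖Real.sin (t * x)‖ ≤ 1 := fun x ↦ abs_sin_le_one _
  have hcos : ∀ x : ℝ, ‖t * Real.cos (t * x)‖ ≤ |t| := fun x ↦ by
    rw [norm_mul, Real.norm_eq_abs]
    exact mul_le_of_le_one_right (abs_nonneg t) (abs_cos_le_one _)
  rw [integral_mul_deriv_eq_deriv_mul_of_integrable (fun x _ ↦ hu x) (fun x _ ↦ hv x),
    ← integral_cos_mul_exp_neg_mul_sq hb, ← MeasureTheory.integral_const_mul,
    ← MeasureTheory.integral_neg]
  · congr 1 with x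
    field_simp
  · exact (integrable_mul_exp_neg_mul_sq hb).bdd_mul
      (by fun_prop) (.of_forall hsin)
  · exact hgauss.bdd_mul (by fun_prop) (.of_forall hcos)
  · exact hgauss.bdd_mul (by fun_prop) (.of_forall hsin)

theorem setIntegral_sin_mul_sin_mul_sin (x : ℝ) :
    ∫ θ in Set.Ioo (-π) π, Real.sin θ * Real.sin (x * Real.sin θ) = 2 * π * besselJ1 x := by
  have hc : ∫ θ in (0 : ℝ)..π, Real.cos θ * Real.cos (x * Real.sin θ) = 0 := by
    have h := integral_comp_sub_left (a := 0) (b := π)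
      (fun θ ↦ Real.cos θ * Real.cos (x * Real.sin θ)) π
    simp only [Real.cos_pi_sub, Real.sin_pi_sub, neg_mul, intervalIntegral.integral_neg, sub_self,
      sub_zero] at h
    linarith
  have hJ : ∫ θ in (0 : ℝ)..π, Real.sin θ * Real.sin (x * Real.sin θ) = π * besselJ1 x := by
    simp only [besselJ1, Real.cos_sub]
    rw [intervalIntegral.integral_add (Continuous.intervalIntegrable (by fun_prop) _ _)
      (Continuous.intervalIntegrable (by fun_prop) _ _), hc, zero_add,
      ← mul_assoc, mul_one_div_cancel pi_ne_zero, one_mul]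
  have hneg : ∫ θ in (-π)..0, Real.sin θ * Real.sin (x * Real.sin θ)
      = ∫ θ in (0 : ℝ)..π, Real.sin θ * Real.sin (x * Real.sin θ) := by
    have h := integral_comp_neg (a := 0) (b := π)
      (fun θ ↦ Real.sin θ * Real.sin (x * Real.sin θ))
    simpa using h.symm
  rw [← integral_Ioc_eq_integral_Ioo, ← integral_of_le (by linarith [pi_pos]),
    ← integral_add_adjacent_intervals (b := 0) (Continuous.intervalIntegrable (by fun_prop) _ _)
      (Continuous.intervalIntegrable (by fun_prop) _ _), hneg, hJ]
  ring

theorem hankel1_gaussian (a p : ℝ) (ha : 0 < a) (hp : 0 ≤ p) :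
    ∫ r in Set.Ioi (0 : ℝ), Real.exp (-a ^ 2 * r ^ 2) * r ^ 2 * besselJ1 (p * r)
      = (p / (4 * a ^ 4)) * Real.exp (-p ^ 2 / (4 * a ^ 2)) := by
  have hb : 0 < a ^ 2 := by positivity
  have hcart : ∫ z : ℝ × ℝ, Real.exp (-a ^ 2 * z.1 ^ 2) *
      (Real.sin (p * z.2) * (z.2 * Real.exp (-a ^ 2 * z.2 ^ 2)))
      = π * (p / (2 * a ^ 4) * Real.exp (-p ^ 2 / (4 * a ^ 2))) := by
    rw [Measure.volume_eq_prod, integral_prod_mul (fun x ↦ Real.exp (-a ^ 2 * x ^ 2))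
      (fun y ↦ Real.sin (p * y) * (y * Real.exp (-a ^ 2 * y ^ 2))), integral_gaussian,
      integral_sin_mul_mul_exp_neg_mul_sq hb]
    have hs : √(π / a ^ 2) * √(π / a ^ 2) = π / a ^ 2 := Real.mul_self_sqrt (by positivity)
    calc _ = √(π / a ^ 2) * √(π / a ^ 2) * (p / (2 * a ^ 2) * Real.exp (-p ^ 2 / (4 * a ^ 2))) := by
          ring
      _ = _ := by rw [hs]; field_simp
  have hpolar (r θ : ℝ) : r • (Real.exp (-a ^ 2 * (r * Real.cos θ) ^ 2) *
      (Real.sin (p * (r * Real.sin θ)) *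
        (r * Real.sin θ * Real.exp (-a ^ 2 * (r * Real.sin θ) ^ 2))))
      = Real.exp (-a ^ 2 * r ^ 2) * r ^ 2 * (Real.sin θ * Real.sin (p * r * Real.sin θ)) := by
    have he : Real.exp (-a ^ 2 * r ^ 2) = Real.exp (-a ^ 2 * (r * Real.cos θ) ^ 2) *
        Real.exp (-a ^ 2 * (r * Real.sin θ) ^ 2) := by
      rw [← Real.exp_add]
      congr 1
      linear_combination a ^ 2 * r ^ 2 * Real.sin_sq_add_cos_sq θ
    rw [he, smul_eq_mul, mul_assoc p]
    ring
  have hint : IntegrableOn (fun z : ℝ × ℝ ↦ Real.exp (-a ^ 2 * z.1 ^ 2) * z.1 ^ 2 *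
      (Real.sin z.2 * Real.sin (p * z.1 * Real.sin z.2)))
      (Set.Ioi 0 ×ˢ Set.Ioo (-π) π) (volume.prod volume) := by
    have hr : Integrable fun r : ℝ ↦ Real.exp (-a ^ 2 * r ^ 2) * r ^ 2 := by
      simpa [mul_comm] using integrable_rpow_mul_exp_neg_mul_sq hb (s := 2) (by norm_num)
    rw [IntegrableOn, ← Measure.prod_restrict]
    have h1 := (hr.integrableOn (s := Set.Ioi 0)).integrable.mul_prod
      (integrable_const (1 : ℝ) (μ := volume.restrict (Set.Ioo (-π) π)))
    simp only [mul_one] at h1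
    refine h1.mul_bdd (c := 1) (by fun_prop) (.of_forall fun z ↦ ?_)
    rw [norm_mul]
    exact mul_le_one₀ (abs_sin_le_one _) (norm_nonneg _) (abs_sin_le_one _)
  rw [← integral_comp_polarCoord_symm] at hcart
  simp only [polarCoord_symm_apply, hpolar, polarCoord_target] at hcart
  rw [Measure.volume_eq_prod, setIntegral_prod _ hint] at hcart
  simp only [MeasureTheory.integral_const_mul, setIntegral_sin_mul_sin_mul_sin] at hcart
  have hfactor : ∫ r in Set.Ioi (0 : ℝ), Real.exp (-a ^ 2 * r ^ 2) * r ^ 2 *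
      (2 * π * besselJ1 (p * r)) = 2 * π * ∫ r in Set.Ioi (0 : ℝ),
        Real.exp (-a ^ 2 * r ^ 2) * r ^ 2 * besselJ1 (p * r) := by
    rw [← MeasureTheory.integral_const_mul]
    congr 1 with r
    ring
  rw [hfactor] at hcart
  refine mul_left_cancel₀ (mul_pos two_pos pi_pos).ne' (hcart.trans ?_)
  ring
end
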